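/- Let n ≥ 1, k ∈ ℕ, d ≥ 0 a real number, T > 0, κ > 0. Let a = (a_1,…,a_n) be a family of continuous functions of t alone (independent of x) on [0,T] with Σ_{i=1}^n sup_t |a_i(t)| ≤ 1/κ. Let u be a sufficiently smooth (C^{k+1}) solution of u_t + Σ_{i=1}^n a_i(t) u_{x_i} = f(x,t) on ℝⁿ × [0,T] with u(x,0) = u₀(x), such that (1+|x|)^{d+|α|} ∂^α_x u(t,·) ∈ L²(ℝⁿ) for all |α| ≤ k and all t. If u₀ ∈ H^k_d(ℝⁿ) and f is continuous in t with f(t,·) ∈ H^k_d(ℝⁿ) for each t, then there exist positive constants δ₁ and C₁ depending only on κ, d, k and T such that for all t ∈ [0,T]: e^{−δ₁ t} ‖u(t,·)‖²_{H^k_d(ℝⁿ)} ≤ ‖u₀‖²_{H^k_d(ℝⁿ)} + C₁ ∫₀ᵗ e^{−δ₁ s} ‖f(s,·)‖²_{H^k_d(ℝⁿ)} ds. -/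

import Mathlib

open MeasureTheory Real Set

noncomputable section

/-- Membership in the weighted Sobolev space `H^k_d(ℝⁿ)`:
`(1+|x|)^{d+m} D^m g ∈ L²(ℝⁿ)` for all `m ≤ k`. -/
def MemHkd (n k : ℕ) (d : ℝ) (g : EuclideanSpace ℝ (Fin n) → ℝ) : Prop :=
  ∀ m : ℕ, m ≤ k →
    Integrable (fun x : EuclideanSpace ℝ (Fin n) =>
      ((1 + ‖x‖) ^ (d + (m : ℝ)) * ‖iteratedFDeriv ℝ m g x‖) ^ 2)

/-- The squared `H^k_d(ℝⁿ)` norm (a max over the orders of derivation). -/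
noncomputable def HkdNormSq (n k : ℕ) (d : ℝ) (g : EuclideanSpace ℝ (Fin n) → ℝ) : ℝ :=
  ⨆ m : Fin (k + 1), ∫ x : EuclideanSpace ℝ (Fin n),
    ((1 + ‖x‖) ^ (d + ((m : ℕ) : ℝ)) * ‖iteratedFDeriv ℝ (m : ℕ) g x‖) ^ 2

universe u

section Transport

variable {E : Type*} [NormedAddCommGroup E] [NormedSpace ℝ E] {T : ℝ}

theorem uniqueDiffOn_univ_prod_Icc (hT : 0 < T) :
    UniqueDiffOn ℝ ((univ : Set E) ×ˢ Icc (0 : ℝ) T) :=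
  uniqueDiffOn_univ.prod (uniqueDiffOn_Icc hT)

theorem hasFDerivAt_slice {F : Type*} [NormedAddCommGroup F] [NormedSpace ℝ F]
    {G : E × ℝ → F} {I : Set ℝ} {x : E} {t : ℝ} (ht : t ∈ I)
    {G' : E × ℝ →L[ℝ] F} (hG : HasFDerivWithinAt G G' (univ ×ˢ I) (x, t)) :
    HasFDerivAt (fun y => G (y, t)) (G'.comp (ContinuousLinearMap.inl ℝ E ℝ)) x := by
  have h1 : HasFDerivWithinAt (fun y : E => (y, t)) (ContinuousLinearMap.inl ℝ E ℝ) univ x :=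
    (hasFDerivAt_prodMk_left x t).hasFDerivWithinAt
  exact hasFDerivWithinAt_univ.1
    (HasFDerivWithinAt.comp x hG h1 fun y _ => mk_mem_prod (mem_univ y) ht)

theorem continuousOn_and_norm_le_of_transport {F : Type*} [NormedAddCommGroup F]
    [NormedSpace ℝ F] [CompleteSpace F] {b B : ℝ → E} (hb : Continuous b)
    (hB : ∀ t, HasDerivAt B (b t) t) {U : E × ℝ → F} (hT : 0 < T)
    (hU : ContDiffOn ℝ 1 U (univ ×ˢ Icc 0 T)) {f : E → ℝ → F}
    (hf : ∀ x, ∀ t ∈ Icc 0 T, f x t = fderivWithin ℝ U (univ ×ˢ Icc 0 T) (x, t) (b t, 1)) :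
    ContinuousOn (fun p : E × ℝ => f p.1 p.2) (univ ×ˢ Icc 0 T) ∧
    ∀ y, ∀ t ∈ Icc 0 T,
      ‖U (y + B t, t)‖ ≤ ‖U (y + B 0, 0)‖ + ∫ s in (0 : ℝ)..t, ‖f (y + B s) s‖ := by
  have hfc : ContinuousOn (fun p : E × ℝ => f p.1 p.2) (univ ×ˢ Icc 0 T) := by
    have h1 := hU.continuousOn_fderivWithin (uniqueDiffOn_univ_prod_Icc hT) le_rfl
    have h2 : ContinuousOn (fun p : E × ℝ => ((b p.2, 1) : E × ℝ)) (univ ×ˢ Icc 0 T) := by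
      fun_prop
    exact (h1.clm_apply h2).congr fun p hp => hf p.1 p.2 hp.2
  refine ⟨hfc, fun y t ht => ?_⟩
  have hBc : Continuous B := continuous_iff_continuousAt.2 fun t => (hB t).continuousAt
  have hsub : Icc 0 t ⊆ Icc 0 T := Icc_subset_Icc_right ht.2
  have hmaps : MapsTo (fun s => (y + B s, s)) (Icc 0 t) ((univ : Set E) ×ˢ Icc 0 T) :=
    fun s hs => ⟨mem_univ _, hsub hs⟩
  have hgc : ContinuousOn (fun s => f (y + B s) s) (Icc 0 t) :=
    hfc.comp (f := fun s => (y + B s, s)) (by fun_prop) hmaps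
  have hUc : ContinuousOn (fun s => U (y + B s, s)) (Icc 0 t) :=
    hU.continuousOn.comp (f := fun s => (y + B s, s)) (by fun_prop) hmaps
  have hderiv : ∀ s ∈ Ioo 0 t, HasDerivAt (fun s => U (y + B s, s)) (f (y + B s) s) s := by
    intro s hs
    have hs' : s ∈ Ioo 0 T := ⟨hs.1, hs.2.trans_le ht.2⟩
    have hd := (hU.differentiableOn one_ne_zero (y + B s, s)
      ⟨mem_univ _, Ioo_subset_Icc_self hs'⟩).hasFDerivWithinAt
    have hc : HasDerivAt (fun s => (y + B s, s)) (b s, 1) s :=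
      ((hB s).const_add y).prodMk (hasDerivAt_id s)
    have := hd.comp_hasDerivWithinAt (f := fun s => (y + B s, s)) s
      (hc.hasDerivWithinAt (s := Icc 0 T)) fun r hr => ⟨mem_univ _, hr⟩
    rw [hf _ _ (Ioo_subset_Icc_self hs')]
    exact this.hasDerivAt (Icc_mem_nhds hs'.1 hs'.2)
  have hftc := intervalIntegral.integral_eq_sub_of_hasDerivAt_of_le ht.1 hUc hderiv
    (hgc.intervalIntegrable_of_Icc ht.1)
  have h3 := intervalIntegral.norm_integral_le_integral_norm (f := fun s => f (y + B s) s)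
    (μ := volume) ht.1
  rw [hftc] at h3
  linarith [norm_le_norm_add_norm_sub' (U (y + B t, t)) (U (y + B 0, 0))]

theorem iteratedFDeriv_transport {E : Type u} [NormedAddCommGroup E] [NormedSpace ℝ E]
    {b B : ℝ → E} (hb : Continuous b)
    (hB : ∀ t, HasDerivAt B (b t) t) (hT : 0 < T) (m : ℕ) :
    ∀ {F : Type u} [NormedAddCommGroup F] [NormedSpace ℝ F] [CompleteSpace F] {U : E × ℝ → F}
      (_ : ContDiffOn ℝ (m + 1) U (univ ×ˢ Icc 0 T)) {f : E → ℝ → F}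
      (_ : ∀ x, ∀ t ∈ Icc 0 T, f x t = fderivWithin ℝ U (univ ×ˢ Icc 0 T) (x, t) (b t, 1)),
    ContinuousOn (fun p : E × ℝ => ‖iteratedFDeriv ℝ m (fun x => f x p.2) p.1‖)
      (univ ×ˢ Icc 0 T) ∧
    ∀ y, ∀ t ∈ Icc 0 T,
      ‖iteratedFDeriv ℝ m (fun x => U (x, t)) (y + B t)‖ ≤
        ‖iteratedFDeriv ℝ m (fun x => U (x, 0)) (y + B 0)‖ +
          ∫ s in (0 : ℝ)..t, ‖iteratedFDeriv ℝ m (fun x => f x s) (y + B s)‖ := by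
  induction m with
  | zero =>
    intro F _ _ _ U hU f hf
    obtain ⟨h1, h2⟩ := continuousOn_and_norm_le_of_transport hb hB hT (by simpa using hU) hf
    simp only [norm_iteratedFDeriv_zero]
    exact ⟨h1.norm, h2⟩
  | succ m ih =>
    intro F _ _ _ U hU f hf
    set S : Set (E × ℝ) := univ ×ˢ Icc 0 T with hS
    have hS' : UniqueDiffOn ℝ S := uniqueDiffOn_univ_prod_Icc hT
    have hDU : ContDiffOn ℝ (m + 1) (fderivWithin ℝ U S) S :=
      hU.fderivWithin hS' (by push_cast; exact le_rfl)
    have hUd : DifferentiableOn ℝ U S := hU.differentiableOn (by simp)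
    have hDUd : DifferentiableOn ℝ (fderivWithin ℝ U S) S := hDU.differentiableOn (by simp)
    set L := (ContinuousLinearMap.compL ℝ E (E × ℝ) F).flip (ContinuousLinearMap.inl ℝ E ℝ)
    have hW : ContDiffOn ℝ (m + 1) (fun p => L (fderivWithin ℝ U S p)) S :=
      L.contDiff.comp_contDiffOn hDU
    obtain ⟨h1, h2⟩ := ih hW (f := fun x t => fderivWithin ℝ
      (fun p => L (fderivWithin ℝ U S p)) S (x, t) (b t, 1)) fun _ _ _ => rfl
    have hUx : ∀ t ∈ Icc 0 T, fderiv ℝ (fun x => U (x, t)) =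
        fun x => L (fderivWithin ℝ U S (x, t)) := fun t ht => funext fun x =>
      (hasFDerivAt_slice ht (hUd (x, t) ⟨mem_univ _, ht⟩).hasFDerivWithinAt).fderiv
    have hfx : ∀ t ∈ Icc 0 T, fderiv ℝ (fun x => f x t) = fun x => fderivWithin ℝ
        (fun p => L (fderivWithin ℝ U S p)) S (x, t) (b t, 1) := by
      intro t ht
      funext x
      have hmem : (x, t) ∈ S := ⟨mem_univ _, ht⟩
      have hD2 := (hDUd (x, t) hmem).hasFDerivWithinAt
      have hsymm : IsSymmSndFDerivWithinAt ℝ U S (x, t) := by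
        refine (hU (x, t) hmem).isSymmSndFDerivWithinAt ?_ hS' ?_ hmem
        · simp only [minSmoothness_of_isRCLikeNormedField]
          norm_cast
          omega
        · rw [hS, interior_prod_eq, interior_univ, interior_Icc, closure_prod_eq,
            closure_Ioo hT.ne]
          exact ⟨by simp, ht⟩
      have hfun : (fun x => f x t) = fun x => fderivWithin ℝ U S (x, t) (b t, 1) :=
        funext fun x => hf x t ht
      have hL : HasFDerivWithinAt (fun p => L (fderivWithin ℝ U S p)) _ S (x, t) :=
        L.hasFDerivAt.comp_hasFDerivWithinAt _ hD2
      rw [hfun, hL.fderivWithin (hS' _ hmem),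
        ((hasFDerivAt_slice ht hD2).clm_apply (hasFDerivAt_const _ _)).fderiv]
      ext v
      simpa [L] using hsymm.eq (v, 0) (b t, 1)
    constructor
    · refine h1.congr fun p hp => ?_
      rw [← norm_iteratedFDeriv_fderiv, hfx _ hp.2]
    · intro y t ht
      simp only [← norm_iteratedFDeriv_fderiv (n := m)]
      rw [hUx t ht, hUx 0 ⟨le_rfl, hT.le⟩]
      refine (h2 y t ht).trans_eq ?_
      congr 1
      refine intervalIntegral.integral_congr fun s hs => ?_
      rw [uIcc_of_le ht.1] at hs
      simp only [hfx s (Icc_subset_Icc_right ht.2 hs)]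

end Transport

theorem sq_le_exp_mul_of_le_add_integral {p p₀ t : ℝ} {q : ℝ → ℝ} (ht : 0 ≤ t) (hp : 0 ≤ p)
    (hq : ContinuousOn q (Icc 0 t)) (h : p ≤ p₀ + ∫ s in (0 : ℝ)..t, q s) :
    p ^ 2 ≤ exp t * (p₀ ^ 2 + ∫ s in (0 : ℝ)..t, exp (-s) * q s ^ 2) := by
  set J := ∫ s in (0 : ℝ)..t, q s
  set l := exp (-t) * (p₀ + J) with hl
  have hexp : exp t * exp (-t) = 1 := by rw [← exp_add]; simp
  have hi : ∀ g : ℝ → ℝ, ContinuousOn g (Icc 0 t) → IntervalIntegrable g volume 0 t :=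
    fun g hg => hg.intervalIntegrable_of_Icc ht
  have h0 : 0 ≤ ∫ s in (0 : ℝ)..t, exp (-s) * (q s - l * exp s) ^ 2 :=
    intervalIntegral.integral_nonneg ht fun s _ => by positivity
  have h1 : ∫ s in (0 : ℝ)..t, exp (-s) * (q s - l * exp s) ^ 2 =
      (∫ s in (0 : ℝ)..t, exp (-s) * q s ^ 2) - 2 * l * J + l ^ 2 * (exp t - 1) := by
    have : ∀ s, exp (-s) * (q s - l * exp s) ^ 2 =
        exp (-s) * q s ^ 2 - 2 * l * q s + l ^ 2 * exp s := fun s => by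
      have : exp (-s) * exp s = 1 := by rw [← exp_add]; simp
      linear_combination (-2 * l * q s + l ^ 2 * exp s) * this
    simp_rw [this]
    rw [intervalIntegral.integral_add, intervalIntegral.integral_sub,
      intervalIntegral.integral_const_mul, intervalIntegral.integral_const_mul, integral_exp,
      exp_zero]
    all_goals exact hi _ (by fun_prop)
  have h2 : exp (-t) * (p₀ + J) ^ 2 ≤ p₀ ^ 2 + ∫ s in (0 : ℝ)..t, exp (-s) * q s ^ 2 := by
    have e : exp t * l = p₀ + J := by rw [hl, ← mul_assoc, hexp, one_mul]
    have : l ^ 2 * exp t = exp (-t) * (p₀ + J) ^ 2 := by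
      rw [← e]
      linear_combination (-l ^ 2 * exp t) * hexp
    have : l * (p₀ + J) = exp (-t) * (p₀ + J) ^ 2 := by rw [hl]; ring
    nlinarith [sq_nonneg (p₀ - l)]
  calc p ^ 2 ≤ (p₀ + J) ^ 2 := by gcongr
    _ = exp t * (exp (-t) * (p₀ + J) ^ 2) := by rw [← mul_assoc, hexp, one_mul]
    _ ≤ _ := by gcongr

theorem one_add_norm_rpow_le {E : Type*} [SeminormedAddCommGroup E] {x z : E} {r c : ℝ}
    (hr : 0 ≤ r) (h : ‖x - z‖ ≤ c) :
    (1 + ‖x‖) ^ r ≤ exp (r * c) * (1 + ‖z‖) ^ r := by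
  have hc : 0 ≤ c := (norm_nonneg _).trans h
  have h1 : 1 + ‖x‖ ≤ exp c * (1 + ‖z‖) := by
    nlinarith [norm_le_norm_add_norm_sub' x z, add_one_le_exp c, norm_nonneg z]
  calc (1 + ‖x‖) ^ r ≤ (exp c * (1 + ‖z‖)) ^ r := by gcongr
    _ = _ := by rw [mul_rpow (exp_pos c).le (by positivity), ← exp_mul, mul_comm c r]

theorem weighted_transport_sq_le {E : Type*} [NormedAddCommGroup E] {T c r l : ℝ}
    {B : ℝ → E} (hB : Continuous B) (hB0 : B 0 = 0)
    (hBc : ∀ s t, s ≤ t → ‖B t - B s‖ ≤ c * (t - s)) (hr : 0 ≤ r) (hc : r * c ≤ l)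
    {P Q : E → ℝ → ℝ} (hP : ∀ x t, 0 ≤ P x t) (hQ : ∀ x t, 0 ≤ Q x t)
    (hQc : ContinuousOn (fun p : E × ℝ => Q p.1 p.2) (univ ×ˢ Icc 0 T))
    (hPQ : ∀ y, ∀ t ∈ Icc 0 T,
      P (y + B t) t ≤ P (y + B 0) 0 + ∫ s in (0 : ℝ)..t, Q (y + B s) s)
    (y : E) {t : ℝ} (ht : t ∈ Icc 0 T) :
    ((1 + ‖y + B t‖) ^ r * P (y + B t) t) ^ 2 ≤
      exp ((2 * l + 1) * t) * (((1 + ‖y‖) ^ r * P y 0) ^ 2 +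
        ∫ s in (0 : ℝ)..t, exp (-(2 * l + 1) * s) *
          ((1 + ‖y + B s‖) ^ r * Q (y + B s) s) ^ 2) := by
  have hw : ∀ s ∈ Icc 0 t,
      exp (-l * t) * (1 + ‖y + B t‖) ^ r ≤ exp (-l * s) * (1 + ‖y + B s‖) ^ r := by
    intro s hs
    have h1 := one_add_norm_rpow_le (x := y + B t) (z := y + B s) hr
      (by simpa using hBc s t hs.2)
    calc exp (-l * t) * (1 + ‖y + B t‖) ^ r
        ≤ exp (-l * t) * (exp (r * (c * (t - s))) * (1 + ‖y + B s‖) ^ r) := by gcongr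
      _ = exp (-l * t + r * c * (t - s)) * (1 + ‖y + B s‖) ^ r := by
        rw [exp_add]; ring_nf
      _ ≤ exp (-l * s) * (1 + ‖y + B s‖) ^ r := by
        gcongr
        nlinarith [hs.2]
  have hQs : ContinuousOn (fun s => Q (y + B s) s) (Icc 0 t) :=
    hQc.comp (f := fun s => (y + B s, s)) (by fun_prop)
      fun s hs => ⟨mem_univ _, Icc_subset_Icc_right ht.2 hs⟩
  have hwc : Continuous fun s => (1 + ‖y + B s‖) ^ r :=
    (by fun_prop : Continuous fun s => 1 + ‖y + B s‖).rpow_const fun _ => Or.inr hr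
  have hqc : ContinuousOn (fun s => exp (-l * s) * (1 + ‖y + B s‖) ^ r * Q (y + B s) s)
      (Icc 0 t) := (Continuous.continuousOn (by fun_prop)).mul hQs
  have hle : exp (-l * t) * (1 + ‖y + B t‖) ^ r * P (y + B t) t ≤
      (1 + ‖y‖) ^ r * P y 0 +
        ∫ s in (0 : ℝ)..t, exp (-l * s) * (1 + ‖y + B s‖) ^ r * Q (y + B s) s := by
    have h0 := hw 0 ⟨le_rfl, ht.1⟩
    simp only [hB0, add_zero, mul_zero, exp_zero, one_mul] at h0
    have h2 := hPQ y t ht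
    rw [hB0, add_zero] at h2
    calc exp (-l * t) * (1 + ‖y + B t‖) ^ r * P (y + B t) t
        ≤ exp (-l * t) * (1 + ‖y + B t‖) ^ r * (P y 0 + ∫ s in (0 : ℝ)..t, Q (y + B s) s) := by
          gcongr
      _ = exp (-l * t) * (1 + ‖y + B t‖) ^ r * P y 0 +
          ∫ s in (0 : ℝ)..t, exp (-l * t) * (1 + ‖y + B t‖) ^ r * Q (y + B s) s := by
          rw [intervalIntegral.integral_const_mul, mul_add]
      _ ≤ _ := by
          refine add_le_add (mul_le_mul_of_nonneg_right h0 (hP _ _)) ?_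
          refine intervalIntegral.integral_mono_on ht.1
            ((hQs.intervalIntegrable_of_Icc ht.1).const_mul _)
            (hqc.intervalIntegrable_of_Icc ht.1) fun s hs => ?_
          exact mul_le_mul_of_nonneg_right (hw s hs) (hQ _ _)
  have key := sq_le_exp_mul_of_le_add_integral ht.1
    (mul_nonneg (by positivity) (hP _ _)) hqc hle
  have e1 : ((1 + ‖y + B t‖) ^ r * P (y + B t) t) ^ 2 = exp (2 * l * t) *
      (exp (-l * t) * (1 + ‖y + B t‖) ^ r * P (y + B t) t) ^ 2 := by
    have : exp (2 * l * t) * exp (-l * t) ^ 2 = 1 := by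
      rw [← exp_nat_mul, ← exp_add]
      simp
      ring
    linear_combination (-((1 + ‖y + B t‖) ^ r * P (y + B t) t) ^ 2) * this
  have e2 : ∀ s, exp (-s) * (exp (-l * s) * (1 + ‖y + B s‖) ^ r * Q (y + B s) s) ^ 2 =
      exp (-(2 * l + 1) * s) * ((1 + ‖y + B s‖) ^ r * Q (y + B s) s) ^ 2 := by
    intro s
    have : exp (-(2 * l + 1) * s) = exp (-s) * exp (-l * s) ^ 2 := by
      rw [← exp_nat_mul, ← exp_add]
      push_cast
      ring_nf
    rw [this]
    ring
  simp_rw [e2] at key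
  rw [e1, show (2 * l + 1) * t = 2 * l * t + t by ring, exp_add, mul_assoc (exp (2 * l * t))]
  gcongr

theorem lintegral_weighted_transport_le {E : Type*} [NormedAddCommGroup E] [MeasurableSpace E]
    [BorelSpace E] [SecondCountableTopology E] {μ : Measure E} [SFinite μ]
    [μ.IsAddRightInvariant] {T c r l : ℝ}
    {B : ℝ → E} (hB : Continuous B) (hB0 : B 0 = 0)
    (hBc : ∀ s t, s ≤ t → ‖B t - B s‖ ≤ c * (t - s)) (hr : 0 ≤ r) (hc : r * c ≤ l)
    {P Q : E → ℝ → ℝ} (hP : ∀ x t, 0 ≤ P x t) (hQ : ∀ x t, 0 ≤ Q x t)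
    (hQc : ContinuousOn (fun p : E × ℝ => Q p.1 p.2) (univ ×ˢ Icc 0 T))
    (hPQ : ∀ y, ∀ t ∈ Icc 0 T,
      P (y + B t) t ≤ P (y + B 0) 0 + ∫ s in (0 : ℝ)..t, Q (y + B s) s)
    {t : ℝ} (ht : t ∈ Icc 0 T) :
    ∫⁻ x, .ofReal (((1 + ‖x‖) ^ r * P x t) ^ 2) ∂μ ≤
      .ofReal (exp ((2 * l + 1) * t)) * (∫⁻ x, .ofReal (((1 + ‖x‖) ^ r * P x 0) ^ 2) ∂μ +
        ∫⁻ s in Ioc 0 t, .ofReal (exp (-(2 * l + 1) * s)) *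
          ∫⁻ x, .ofReal (((1 + ‖x‖) ^ r * Q x s) ^ 2) ∂μ) := by
  set h : E → ℝ → ℝ := fun y s =>
    exp (-(2 * l + 1) * s) * ((1 + ‖y + B s‖) ^ r * Q (y + B s) s) ^ 2 with hh
  have hwc : Continuous fun p : E × ℝ => (1 + ‖p.1 + B p.2‖) ^ r :=
    (by fun_prop : Continuous fun p : E × ℝ => 1 + ‖p.1 + B p.2‖).rpow_const fun _ => Or.inr hr
  have hcont : ContinuousOn (fun p : E × ℝ => h p.1 p.2) (univ ×ˢ Icc 0 t) := by
    have : ContinuousOn (fun p : E × ℝ => Q (p.1 + B p.2) p.2) (univ ×ˢ Icc 0 t) :=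
      hQc.comp (f := fun p : E × ℝ => (p.1 + B p.2, p.2)) (by fun_prop)
        fun p hp => ⟨mem_univ _, Icc_subset_Icc_right ht.2 hp.2⟩
    exact (Continuous.continuousOn (by fun_prop)).mul ((hwc.continuousOn.mul this).pow 2)
  have hmeas : AEMeasurable (fun p : E × ℝ => ENNReal.ofReal (h p.1 p.2))
      (μ.prod (volume.restrict (Ioc 0 t))) := by
    rw [← Measure.restrict_univ (μ := μ), Measure.prod_restrict]
    exact ((hcont.mono (prod_mono_right Ioc_subset_Icc_self)).aemeasurable
      (MeasurableSet.univ.prod measurableSet_Ioc)).ennreal_ofReal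
  have hpt : ∀ y, ENNReal.ofReal (((1 + ‖y + B t‖) ^ r * P (y + B t) t) ^ 2) ≤
      .ofReal (exp ((2 * l + 1) * t)) * (.ofReal (((1 + ‖y‖) ^ r * P y 0) ^ 2) +
        ∫⁻ s in Ioc 0 t, .ofReal (h y s)) := by
    intro y
    have hyc : ContinuousOn (h y) (Icc 0 t) :=
      hcont.comp (f := fun s => (y, s)) (by fun_prop) fun s hs => ⟨mem_univ _, hs⟩
    rw [← ofReal_integral_eq_lintegral_ofReal
      (hyc.integrableOn_Icc.mono_set Ioc_subset_Icc_self)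
      (ae_of_all _ fun s => by simp only [hh, Pi.zero_apply]; positivity),
      ← ENNReal.ofReal_add (by positivity)
        (integral_nonneg fun s => by simp only [hh, Pi.zero_apply]; positivity),
      ← ENNReal.ofReal_mul (exp_pos _).le, ← intervalIntegral.integral_of_le ht.1]
    exact ENNReal.ofReal_le_ofReal
      (weighted_transport_sq_le hB hB0 hBc hr hc hP hQ hQc hPQ y ht)
  have hswap : ∫⁻ y, (∫⁻ s in Ioc 0 t, .ofReal (h y s)) ∂μ =
      ∫⁻ s in Ioc 0 t, .ofReal (exp (-(2 * l + 1) * s)) *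
          ∫⁻ x, .ofReal (((1 + ‖x‖) ^ r * Q x s) ^ 2) ∂μ := by
    rw [lintegral_lintegral_swap hmeas]
    refine lintegral_congr fun s => ?_
    simp only [hh, ENNReal.ofReal_mul (exp_pos _).le]
    rw [lintegral_const_mul' _ _ ENNReal.ofReal_ne_top,
      lintegral_add_right_eq_self (fun x => ENNReal.ofReal (((1 + ‖x‖) ^ r * Q x s) ^ 2)) (B s)]
  rw [← lintegral_add_right_eq_self (fun x => ENNReal.ofReal (((1 + ‖x‖) ^ r * P x t) ^ 2)) (B t)]
  refine (lintegral_mono hpt).trans_eq ?_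
  rw [lintegral_const_mul' _ _ ENNReal.ofReal_ne_top,
    lintegral_add_right' _ hmeas.lintegral_prod_right', hswap]

theorem integral_le_HkdNormSq {n k m : ℕ} (hm : m ≤ k) (d : ℝ)
    (g : EuclideanSpace ℝ (Fin n) → ℝ) :
    ∫ x, ((1 + ‖x‖) ^ (d + (m : ℝ)) * ‖iteratedFDeriv ℝ m g x‖) ^ 2 ≤ HkdNormSq n k d g :=
  le_ciSup (f := fun m : Fin (k + 1) => ∫ x : EuclideanSpace ℝ (Fin n),
    ((1 + ‖x‖) ^ (d + ((m : ℕ) : ℝ)) * ‖iteratedFDeriv ℝ (m : ℕ) g x‖) ^ 2)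
    (Finite.bddAbove_range _) ⟨m, Nat.lt_succ_of_le hm⟩

theorem HkdNormSq_nonneg (n k : ℕ) (d : ℝ) (g : EuclideanSpace ℝ (Fin n) → ℝ) :
    0 ≤ HkdNormSq n k d g :=
  Real.iSup_nonneg fun _ => integral_nonneg fun _ => sq_nonneg _

theorem MemHkd.lintegral_eq {n k m : ℕ} {d : ℝ} {g : EuclideanSpace ℝ (Fin n) → ℝ}
    (hg : MemHkd n k d g) (hm : m ≤ k) :
    ∫⁻ x, ENNReal.ofReal (((1 + ‖x‖) ^ (d + (m : ℝ)) * ‖iteratedFDeriv ℝ m g x‖) ^ 2) =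
      ENNReal.ofReal
        (∫ x, ((1 + ‖x‖) ^ (d + (m : ℝ)) * ‖iteratedFDeriv ℝ m g x‖) ^ 2) :=
  (ofReal_integral_eq_lintegral_ofReal (hg m hm) (ae_of_all _ fun _ => sq_nonneg _)).symm

theorem norm_sum_smul_single_le {n : ℕ} {v A : Fin n → ℝ} (h : ∀ i, |v i| ≤ A i) :
    ‖∑ i, v i • EuclideanSpace.single i (1 : ℝ)‖ ≤ ∑ i, A i :=
  norm_sum_le_of_le _ fun i _ => by simpa [norm_smul] using h i

theorem fderivWithin_strip_apply {n : ℕ} {T t : ℝ} {u : EuclideanSpace ℝ (Fin n) → ℝ → ℝ}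
    {x : EuclideanSpace ℝ (Fin n)} (ht : t ∈ Ioo 0 T) (v : Fin n → ℝ)
    (hu : DifferentiableWithinAt ℝ (fun p : EuclideanSpace ℝ (Fin n) × ℝ => u p.1 p.2)
      (univ ×ˢ Icc 0 T) (x, t)) :
    fderivWithin ℝ (fun p : EuclideanSpace ℝ (Fin n) × ℝ => u p.1 p.2) (univ ×ˢ Icc 0 T) (x, t)
      (∑ i, v i • EuclideanSpace.single i (1 : ℝ), 1) =
    deriv (fun s => u x s) t +
      ∑ i, v i * fderiv ℝ (fun y => u y t) x (EuclideanSpace.single i 1) := by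
  have hd := hu.hasFDerivWithinAt
  have h1 := (hasFDerivAt_slice (Ioo_subset_Icc_self ht) hd).fderiv
  have h2 := (hd.comp_hasDerivWithinAt (f := fun s => (x, s)) t
    (((hasDerivAt_const t x).prodMk (hasDerivAt_id t)).hasDerivWithinAt (s := Icc 0 T))
    fun s hs => ⟨mem_univ _, hs⟩).hasDerivAt (Icc_mem_nhds ht.1 ht.2)
  have h2' := h2.deriv
  simp only [Function.comp_def] at h2'
  rw [h1, h2']
  generalize fderivWithin ℝ (fun p : EuclideanSpace ℝ (Fin n) × ℝ => u p.1 p.2)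
    (univ ×ˢ Icc 0 T) (x, t) = D
  have : (∑ i, v i • EuclideanSpace.single i (1 : ℝ), (1 : ℝ)) =
      ((0, 1) : EuclideanSpace ℝ (Fin n) × ℝ) +
        ContinuousLinearMap.inl ℝ _ ℝ (∑ i, v i • EuclideanSpace.single i (1 : ℝ)) := by
    rw [ContinuousLinearMap.inl_apply, Prod.mk_add_mk, zero_add, add_zero]
  rw [this, map_add, ← ContinuousLinearMap.comp_apply, map_sum]
  simp only [map_smul, smul_eq_mul]

/-- Weighted energy estimate for `u_t + ∑ aᵢ(t) u_{xᵢ} = f` with coefficients depending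
only on `t`: there are `δ₁, C₁ > 0` depending only on `κ` (and `n`, `k`, `d`, `T`) with
`e^{−δ₁ t} ‖u(t)‖²_{H^k_d} ≤ ‖u₀‖²_{H^k_d} + C₁ ∫₀ᵗ e^{−δ₁ s} ‖f(s)‖²_{H^k_d} ds`. -/
theorem energy_estimate_Hkd
    (n : ℕ) (hn : 1 ≤ n) (k : ℕ) (d T κ : ℝ) (hd : 0 ≤ d) (hT : 0 < T) (hκ : 0 < κ) :
    ∃ δ₁ : ℝ, 0 < δ₁ ∧ ∃ C₁ : ℝ, 0 < C₁ ∧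
      ∀ (a : Fin n → ℝ → ℝ)
        (f u : EuclideanSpace ℝ (Fin n) → ℝ → ℝ)
        (u₀ : EuclideanSpace ℝ (Fin n) → ℝ)
        (A : Fin n → ℝ),
        -- the `aᵢ` are continuous functions of `t` alone
        (∀ i, ContinuousOn (a i) (Set.Icc 0 T)) →
        -- `∑ᵢ sup_t |aᵢ(t)| ≤ 1/κ`
        (∀ i, ∀ t ∈ Set.Icc (0:ℝ) T, |a i t| ≤ A i) →
        (∑ i, A i ≤ 1 / κ) →
        -- `u` is a `C^{k+1}` solution of the PDE with initial value `u₀`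
        ContDiffOn ℝ (k + 1) (fun p : EuclideanSpace ℝ (Fin n) × ℝ => u p.1 p.2)
          (Set.univ ×ˢ Set.Icc 0 T) →
        (∀ x, ∀ t ∈ Set.Icc (0:ℝ) T,
          deriv (fun s => u x s) t
            + (∑ i, a i t * fderiv ℝ (fun y => u y t) x (EuclideanSpace.single i 1))
            = f x t) →
        (∀ x, u x 0 = u₀ x) →
        -- `(1+|x|)^{d+|α|} ∂^α_x u(t,·) ∈ L²` for all `|α| ≤ k`
        (∀ t ∈ Set.Icc (0:ℝ) T, MemHkd n k d (fun x => u x t)) →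
        -- `u₀ ∈ H^k_d`
        MemHkd n k d u₀ →
        -- `f ∈ C([0,T]; H^k_d)`
        (∀ t ∈ Set.Icc (0:ℝ) T, MemHkd n k d (fun x => f x t)) →
        ContinuousOn (fun t => HkdNormSq n k d (fun x => f x t)) (Set.Icc 0 T) →
        ∀ t ∈ Set.Icc (0:ℝ) T,
          Real.exp (-δ₁ * t) * HkdNormSq n k d (fun x => u x t)
            ≤ HkdNormSq n k d u₀
              + C₁ * ∫ s in (0:ℝ)..t, Real.exp (-δ₁ * s) * HkdNormSq n k d (fun x => f x s) := by
  set l : ℝ := (d + k) * (1 / κ) with hl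
  have hl0 : 0 ≤ l := by positivity
  refine ⟨2 * l + 1, by positivity, 1, one_pos, ?_⟩
  intro a f u u₀ A ha haA hA hu hpde hu0 huH hu₀ hfH hfc t ht
  set b : ℝ → EuclideanSpace ℝ (Fin n) := fun s =>
    ∑ i, a i (projIcc 0 T hT.le s) • EuclideanSpace.single i (1 : ℝ) with hb
  have hbc : Continuous b := continuous_finsetSum _ fun i _ =>
    ((ha i).domRestrict.comp continuous_projIcc).smul continuous_const
  have hbκ : ∀ s, ‖b s‖ ≤ 1 / κ := fun s =>
    (norm_sum_smul_single_le fun i => haA i _ (projIcc 0 T hT.le s).2).trans hA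
  set B : ℝ → EuclideanSpace ℝ (Fin n) := fun s => ∫ r in (0 : ℝ)..s, b r with hB
  have hBd : ∀ s, HasDerivAt B (b s) s := fun s => (hbc.integral_hasStrictDerivAt 0 s).hasDerivAt
  have hBc : Continuous B := continuous_iff_continuousAt.2 fun s => (hBd s).continuousAt
  have hBl : ∀ s t, s ≤ t → ‖B t - B s‖ ≤ 1 / κ * (t - s) := by
    intro s t hst
    rw [hB, intervalIntegral.integral_interval_sub_left (hbc.intervalIntegrable _ _)
      (hbc.intervalIntegrable _ _), ← abs_of_nonneg (sub_nonneg.2 hst)]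
    exact intervalIntegral.norm_integral_le_of_norm_le_const fun r _ => hbκ r
  set U : EuclideanSpace ℝ (Fin n) × ℝ → ℝ := fun p => u p.1 p.2 with hU
  set g : EuclideanSpace ℝ (Fin n) → ℝ → ℝ := fun x s =>
    fderivWithin ℝ U (univ ×ˢ Icc 0 T) (x, s) (b s, 1) with hg
  have hgf : ∀ s ∈ Ioo 0 T, (fun x => g x s) = fun x => f x s := by
    intro s hs
    funext x
    have hs' := Ioo_subset_Icc_self hs
    rw [← hpde x s hs', hg]
    simp only [hb, projIcc_of_mem hT.le hs']
    exact fderivWithin_strip_apply hs _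
      (hu.differentiableOn (by simp) (x, s) ⟨mem_univ _, hs'⟩)
  set Φ : ℝ → ℝ := fun s => exp (-(2 * l + 1) * s) * HkdNormSq n k d (fun x => f x s) with hΦ
  have hΦ0 : ∀ s, 0 ≤ Φ s := fun s => mul_nonneg (exp_pos _).le (HkdNormSq_nonneg _ _ _ _)
  have hΦc : ContinuousOn Φ (Icc 0 t) :=
    (Continuous.continuousOn (by fun_prop)).mul (hfc.mono (Icc_subset_Icc_right ht.2))
  have hint0 : 0 ≤ ∫ s in (0 : ℝ)..t, Φ s :=
    intervalIntegral.integral_nonneg ht.1 fun s _ => hΦ0 s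
  have hu0' : (fun x => u x 0) = u₀ := funext hu0
  suffices h : HkdNormSq n k d (fun x => u x t) ≤ exp ((2 * l + 1) * t) *
      (HkdNormSq n k d u₀ + ∫ s in (0 : ℝ)..t, Φ s) by
    rw [one_mul, neg_mul, exp_neg, inv_mul_le_iff₀ (exp_pos _)]
    exact h
  refine ciSup_le fun m => ?_
  obtain ⟨m, hm⟩ := m
  have hmk : m ≤ k := Nat.lt_succ_iff.1 hm
  obtain ⟨hgc, htr⟩ := iteratedFDeriv_transport hbc hBd hT m
    (hu.of_le (by gcongr)) (f := g) fun _ _ _ => rfl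
  have hrl : (d + (m : ℝ)) * (1 / κ) ≤ l := by
    rw [hl]
    gcongr
  have key := lintegral_weighted_transport_le (μ := volume) hBc (by simp [hB]) hBl
    (by positivity : 0 ≤ d + (m : ℝ)) hrl
    (P := fun x s => ‖iteratedFDeriv ℝ m (fun x => u x s) x‖)
    (Q := fun x s => ‖iteratedFDeriv ℝ m (fun x => g x s) x‖)
    (fun _ _ => norm_nonneg _) (fun _ _ => norm_nonneg _) hgc htr ht
  have hsource : ∫⁻ s in Ioc 0 t, ENNReal.ofReal (exp (-(2 * l + 1) * s)) *
      ∫⁻ x, .ofReal (((1 + ‖x‖) ^ (d + (m : ℝ)) *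
        ‖iteratedFDeriv ℝ m (fun x => g x s) x‖) ^ 2) ≤
      ENNReal.ofReal (∫ s in (0 : ℝ)..t, Φ s) := by
    rw [intervalIntegral.integral_of_le ht.1, ofReal_integral_eq_lintegral_ofReal
      (hΦc.integrableOn_Icc.mono_set Ioc_subset_Icc_self) (ae_of_all _ hΦ0),
      ← restrict_Ioo_eq_restrict_Ioc]
    refine setLIntegral_mono_ae' measurableSet_Ioo (ae_of_all _ fun s hs => ?_)
    have hs' : s ∈ Ioo 0 T := ⟨hs.1, hs.2.trans_le ht.2⟩
    rw [hgf s hs', (hfH s (Ioo_subset_Icc_self hs')).lintegral_eq hmk,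
      ← ENNReal.ofReal_mul (exp_pos _).le]
    exact ENNReal.ofReal_le_ofReal
      (mul_le_mul_of_nonneg_left (integral_le_HkdNormSq hmk d _) (exp_pos _).le)
  have hfinal := key.trans (mul_le_mul_right (add_le_add le_rfl hsource) _)
  simp only [hu0'] at hfinal
  rw [(huH t ht).lintegral_eq hmk, hu₀.lintegral_eq hmk,
    ← ENNReal.ofReal_add (integral_nonneg fun _ => sq_nonneg _) hint0,
    ← ENNReal.ofReal_mul (exp_pos _).le] at hfinal
  refine ((ENNReal.ofReal_le_ofReal_iff (mul_nonneg (exp_pos _).le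
    (add_nonneg (integral_nonneg fun _ => sq_nonneg _) hint0))).1 hfinal).trans ?_
  gcongr
  exact integral_le_HkdNormSq hmk d u₀
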